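/- Let P, Q, A ∈ P_RCCS be processes, T, R RCCS terms with one free variable X, μ1, μ2, ν1 ∈ D(P_RCCS) distributions, and L ⊆ N a finite set of channels. Then: (1) P|Q ∼p Q|P, P|0 ∼p P, (P|Q)|A ∼p P|(Q|A), and μX.T ∼p T{μX.T/X}; (2) if L ∩ N(Q) = ∅ (no channel of Q lies in L) then (L)Q ∼p Q and ((L)P)|Q ∼p (L)(P|Q); (3) if P ∼p Q then R{P/X} ∼p R{Q/X}; (4) if μ1 ∼p† μ2 and μ1 ⇝ ν1, then there exists ν2 with μ2 ⇝ ν2 and ν1 ∼p† ν2. -/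

import Mathlib

open scoped Classical

/-! ## Channels, actions, RCCS terms -/

/-- Channels, drawn from an infinite set. -/
abbrev Chan := ℕ

/-- Actions: input/output labels over channels, the silent action `τ`, and the
distinguished success action `ω` (used only by observers). -/
inductive Act where
  | inp : Chan → Act
  | out : Chan → Act
  | tau : Act
  | omega : Act
deriving DecidableEq

/-- `α` is an external label, i.e. a member of `𝓛 = N ∪ N̄`. -/
def Act.IsLabel : Act → Prop
  | .inp _ => True
  | .out _ => True
  | _ => False

/-- Complementary labels (for communication). -/
def Act.Comp : Act → Act → Prop := fun x y =>
  ∃ a, (x = .inp a ∧ y = .out a) ∨ (x = .out a ∧ y = .inp a)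

/-- `β, β̄ ∉ L`: the action is not blocked by the localization `(L)-`. -/
def Act.Allowed (L : Finset Chan) : Act → Prop
  | .inp a => a ∉ L
  | .out a => a ∉ L
  | _ => True

/-- Channels occurring in an action. -/
def Act.chans : Act → Finset Chan
  | .inp a => {a}
  | .out a => {a}
  | _ => ∅

/-- RCCS (and RCCS^ω) terms, with de Bruijn indices for process variables.
`sum k acts conts` is the nondeterministic choice `Σ_{i∈I} α_i.T_i` over the
nonempty finite index set `I = Fin (k+1)`, and `oplus k w conts` is the
probabilistic choice `⊕_{i∈I} p_i τ.T_i`. `fix T` is `μX.T` (binding index 0). -/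
inductive Tm where
  | nil : Tm
  | var : ℕ → Tm
  | sum : (k : ℕ) → (Fin (k+1) → Act) → (Fin (k+1) → Tm) → Tm
  | oplus : (k : ℕ) → (Fin (k+1) → ℝ) → (Fin (k+1) → Tm) → Tm
  | par : Tm → Tm → Tm
  | loc : Finset Chan → Tm → Tm
  | fix : Tm → Tm

/-- Substitution `T{P/X}` of a (closed) term `P` for the de Bruijn variable `n`. -/
def Tm.subst (P : Tm) : ℕ → Tm → Tm
  | _, .nil => .nil
  | n, .var m => if m = n then P else .var m
  | n, .sum k a c => .sum k a (fun i => Tm.subst P n (c i))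
  | n, .oplus k w c => .oplus k w (fun i => Tm.subst P n (c i))
  | n, .par S T => .par (Tm.subst P n S) (Tm.subst P n T)
  | n, .loc L T => .loc L (Tm.subst P n T)
  | n, .fix T => .fix (Tm.subst P (n+1) T)

/-- `T` has all its free variables among the first `n` de Bruijn indices.
`ClosedAt 0 T` means `T` is closed; `ClosedAt 1 T` means at most one free variable. -/
def Tm.ClosedAt : ℕ → Tm → Prop
  | _, .nil => True
  | n, .var m => m < n
  | n, .sum _ _ c => ∀ i, Tm.ClosedAt n (c i)
  | n, .oplus _ _ c => ∀ i, Tm.ClosedAt n (c i)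
  | n, .par S T => Tm.ClosedAt n S ∧ Tm.ClosedAt n T
  | n, .loc _ T => Tm.ClosedAt n T
  | n, .fix T => Tm.ClosedAt (n+1) T

/-- The success action `ω` does not occur in `T` (so `T` is a genuine RCCS term). -/
def Tm.NoOmega : Tm → Prop
  | .nil => True
  | .var _ => True
  | .sum _ a c => (∀ i, a i ≠ Act.omega) ∧ (∀ i, Tm.NoOmega (c i))
  | .oplus _ _ c => ∀ i, Tm.NoOmega (c i)
  | .par S T => Tm.NoOmega S ∧ Tm.NoOmega T
  | .loc _ T => Tm.NoOmega T
  | .fix T => Tm.NoOmega T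

/-- No probabilistic choice occurs in `T` (so `T` is a CCS term). -/
def Tm.NoOplus : Tm → Prop
  | .nil => True
  | .var _ => True
  | .sum _ _ c => ∀ i, Tm.NoOplus (c i)
  | .oplus _ _ _ => False
  | .par S T => Tm.NoOplus S ∧ Tm.NoOplus T
  | .loc _ T => Tm.NoOplus T
  | .fix T => Tm.NoOplus T

/-- The channels `N(T)` occurring in a term. -/
def Tm.chans : Tm → Finset Chan
  | .nil => ∅
  | .var _ => ∅
  | .sum _ a c =>
      (Finset.univ.sup fun i => (a i).chans) ∪ (Finset.univ.sup fun i => Tm.chans (c i))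
  | .oplus _ _ c => Finset.univ.sup fun i => Tm.chans (c i)
  | .par S T => S.chans ∪ T.chans
  | .loc L T => L ∪ T.chans
  | .fix T => T.chans

/-- Renaming of channels in an action. -/
def Act.rename (f : Chan → Chan) : Act → Act
  | .inp a => .inp (f a)
  | .out a => .out (f a)
  | x => x

/-- Renaming `T[f]` of the global channels of a term (local channels are untouched). -/
def Tm.rename : (Chan → Chan) → Tm → Tm
  | _, .nil => .nil
  | _, .var m => .var m
  | f, .sum k a c => .sum k (fun i => (a i).rename f) (fun i => Tm.rename f (c i))
  | f, .oplus k w c => .oplus k w (fun i => Tm.rename f (c i))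
  | f, .par S T => .par (Tm.rename f S) (Tm.rename f T)
  | f, .loc L T => .loc L (Tm.rename (fun a => if a ∈ L then a else f a) T)
  | f, .fix T => .fix (Tm.rename f T)

/-- `P` is an RCCS process: closed and without the success action. -/
def Tm.IsProc (P : Tm) : Prop := Tm.ClosedAt 0 P ∧ Tm.NoOmega P

/-- `P` is a CCS process: a process without probabilistic choice. -/
def Tm.IsCCS (P : Tm) : Prop := P.IsProc ∧ Tm.NoOplus P

/-! ## Finitely supported distributions -/

/-- Finitely supported probability distributions on `α`. -/
structure FinDist (α : Type) where
  toFun : α → ℝ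
  nonneg : ∀ a, 0 ≤ toFun a
  finite_support : (Function.support toFun).Finite
  sum_one : ∑ᶠ a, toFun a = 1

namespace FinDist

/-- The probability `μ(φ)` that a predicate (set) `φ` holds under `μ`. -/
noncomputable def mass {α : Type} (μ : FinDist α) (φ : Set α) : ℝ :=
  ∑ᶠ a ∈ φ, μ.toFun a

/-- The Dirac distribution `δ_P`. -/
noncomputable def dirac {α : Type} (P : α) : FinDist α where
  toFun := fun Q => if Q = P then 1 else 0
  nonneg := by intro a; by_cases h : a = P <;> simp [h]
  finite_support := by
    apply Set.Finite.subset (Set.finite_singleton P)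
    intro a ha
    by_contra h
    simp only [Set.mem_singleton_iff] at h
    simp [Function.mem_support, h] at ha
  sum_one := by
    rw [finsum_eq_single _ P (fun b hb => by simp [hb])]
    simp

/-- Pushforward of a finitely supported distribution along a map. -/
noncomputable def map {α β : Type} (g : α → β) (μ : FinDist α) : FinDist β where
  toFun := fun b => ∑ᶠ a ∈ {a | g a = b}, μ.toFun a
  nonneg := by
    intro b
    exact finsum_nonneg fun a => finsum_nonneg fun _ => μ.nonneg a
  finite_support := by
    apply Set.Finite.subset (μ.finite_support.image g)
    intro b hb
    rw [Function.mem_support] at hb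
    by_contra h
    apply hb
    apply finsum_mem_eq_zero_of_forall_eq_zero
    intro a ha
    by_contra ha0
    exact h ⟨a, Function.mem_support.mpr ha0, ha⟩
  sum_one := by
    classical
    set s := μ.finite_support.toFinset with hs
    have hfib : ∀ b : β, (∑ᶠ a ∈ {a | g a = b}, μ.toFun a)
        = ∑ a ∈ s.filter (fun a => g a = b), μ.toFun a := by
      intro b
      apply finsum_mem_eq_sum_of_inter_support_eq
      ext a
      simp only [Set.mem_inter_iff, Set.mem_setOf_eq, Finset.coe_filter,
        Set.Finite.mem_toFinset, Function.mem_support, hs]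
      tauto
    have hsub : Function.support (fun b : β => ∑ᶠ a ∈ {a | g a = b}, μ.toFun a) ⊆
        ↑(s.image g) := by
      intro b hb
      rw [Function.mem_support, hfib] at hb
      obtain ⟨a, ha, hne⟩ := Finset.exists_ne_zero_of_sum_ne_zero hb
      rw [Finset.mem_filter] at ha
      simp only [Finset.coe_image, Set.mem_image, Finset.mem_coe]
      exact ⟨a, ha.1, ha.2⟩
    rw [finsum_eq_finset_sum_of_support_subset _ hsub]
    calc ∑ b ∈ s.image g, ∑ᶠ a ∈ {a | g a = b}, μ.toFun a
        = ∑ b ∈ s.image g, ∑ a ∈ s.filter (fun a => g a = b), μ.toFun a :=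
          Finset.sum_congr rfl fun b _ => hfib b
      _ = ∑ a ∈ s, μ.toFun a :=
          Finset.sum_fiberwise_of_maps_to (fun a ha => Finset.mem_image_of_mem g ha)
            μ.toFun
      _ = 1 := by rw [← finsum_eq_sum μ.toFun μ.finite_support]; exact μ.sum_one

/-- The product of two finitely supported distributions. -/
noncomputable def prod {α β : Type} (μ : FinDist α) (ν : FinDist β) :
    FinDist (α × β) where
  toFun := fun x => μ.toFun x.1 * ν.toFun x.2
  nonneg := fun x => mul_nonneg (μ.nonneg _) (ν.nonneg _)
  finite_support := by
    apply Set.Finite.subset (μ.finite_support.prod ν.finite_support)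
    intro x hx
    rw [Function.mem_support] at hx
    have h := mul_ne_zero_iff.mp hx
    exact ⟨Function.mem_support.mpr h.1, Function.mem_support.mpr h.2⟩
  sum_one := by
    classical
    have hsub : Function.support (fun x : α × β => μ.toFun x.1 * ν.toFun x.2) ⊆
        ↑(μ.finite_support.toFinset ×ˢ ν.finite_support.toFinset) := by
      intro x hx
      rw [Function.mem_support] at hx
      have h := mul_ne_zero_iff.mp hx
      simp only [Finset.coe_product, Set.mem_prod, Set.Finite.coe_toFinset]
      exact ⟨h.1, h.2⟩
    rw [finsum_eq_finset_sum_of_support_subset _ hsub, Finset.sum_product]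
    have h1 : ∑ a ∈ μ.finite_support.toFinset, μ.toFun a = 1 := by
      rw [← finsum_eq_sum μ.toFun μ.finite_support]; exact μ.sum_one
    have h2 : ∑ b ∈ ν.finite_support.toFinset, ν.toFun b = 1 := by
      rw [← finsum_eq_sum ν.toFun ν.finite_support]; exact ν.sum_one
    calc ∑ a ∈ μ.finite_support.toFinset, ∑ b ∈ ν.finite_support.toFinset,
          μ.toFun a * ν.toFun b
        = ∑ a ∈ μ.finite_support.toFinset, μ.toFun a * 1 := by
          refine Finset.sum_congr rfl fun a _ => ?_
          rw [← Finset.mul_sum, h2]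
      _ = 1 := by simpa using h1

/-- Parallel composition `μ | ν` of distributions:
`(μ|ν)(A|B) = μ(A)·ν(B)`. -/
noncomputable def parD (μ ν : FinDist Tm) : FinDist Tm :=
  (μ.prod ν).map fun x => Tm.par x.1 x.2

/-- Localization `(L)μ` of a distribution. -/
noncomputable def locD (L : Finset Chan) (μ : FinDist Tm) : FinDist Tm :=
  μ.map (Tm.loc L)

/-- Renaming `μ[f]` of a distribution. -/
noncomputable def renameD (f : Chan → Chan) (μ : FinDist Tm) : FinDist Tm :=
  μ.map (Tm.rename f)

/-- Instantiation `ϑ[P]` of a 1-ary distribution `ϑ` at the process `P`. -/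
noncomputable def instD (ϑ : FinDist Tm) (P : Tm) : FinDist Tm :=
  ϑ.map (fun T => Tm.subst P 0 T)

/-- Every element of the support is a process (`μ ∈ D(P_RCCS)`). -/
def IsProcDist (μ : FinDist Tm) : Prop := ∀ P, μ.toFun P ≠ 0 → P.IsProc

/-- All channels occurring in (the support of) `μ` lie in `L`. -/
def chansIn (μ : FinDist Tm) (L : Finset Chan) : Prop :=
  ∀ P, μ.toFun P ≠ 0 → P.chans ⊆ L

/-- The channel `a` occurs in (the support of) `μ`, i.e. `a ∈ N(μ)`. -/
def hasChan (μ : FinDist Tm) (a : Chan) : Prop := ∃ P, μ.toFun P ≠ 0 ∧ a ∈ P.chans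

end FinDist

/-! ## Part I: the probabilistic labelled transition system on processes -/

/-- Part I of the pLTS for RCCS (and RCCS^ω): `P →α ρ`. -/
inductive Step : Tm → Act → FinDist Tm → Prop where
  | choice {k : ℕ} (acts : Fin (k+1) → Act) (conts : Fin (k+1) → Tm) (i : Fin (k+1)) :
      Step (.sum k acts conts) (acts i) (FinDist.dirac (conts i))
  | oplus {k : ℕ} (w : Fin (k+1) → ℝ) (conts : Fin (k+1) → Tm) (ρ : FinDist Tm) :
      (∀ i, 0 < w i ∧ w i < 1) →
      (∀ Q, ρ.toFun Q = ∑ i, if conts i = Q then w i else 0) →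
      Step (.oplus k w conts) .tau ρ
  | parL {S : Tm} {α : Act} {ρ : FinDist Tm} (T : Tm) :
      Step S α ρ → Step (.par S T) α (ρ.parD (FinDist.dirac T))
  | parR {T : Tm} {α : Act} {ρ : FinDist Tm} (S : Tm) :
      Step T α ρ → Step (.par S T) α ((FinDist.dirac S).parD ρ)
  | comm {S T : Tm} {ℓ1 ℓ2 : Act} {ρ1 ρ2 : FinDist Tm} :
      Act.Comp ℓ1 ℓ2 → Step S ℓ1 ρ1 → Step T ℓ2 ρ2 →
      Step (.par S T) .tau (ρ1.parD ρ2)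
  | loc {T : Tm} {β : Act} {ρ : FinDist Tm} (L : Finset Chan) :
      Step T β ρ → Act.Allowed L β → Step (.loc L T) β (FinDist.locD L ρ)
  | fixp {T : Tm} {β : Act} {ρ : FinDist Tm} :
      Step (Tm.subst (.fix T) 0 T) β ρ → Step (.fix T) β ρ

/-! ## Part II: probabilistic transitions on distributions -/

/-- Part II of the pLTS: `μ →(α,p) ν` iff `0 < p ≤ 1` and there are `P ∈ supp μ`
and `ρ` with `P →α ρ` and `ν = μ + μ(P)·p·(ρ − δ_P)`. -/
def PStep (μ : FinDist Tm) (α : Act) (p : ℝ) (ν : FinDist Tm) : Prop :=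
  0 < p ∧ p ≤ 1 ∧
    ∃ P ρ, 0 < μ.toFun P ∧ Step P α ρ ∧
      ∀ Q, ν.toFun Q = μ.toFun Q + μ.toFun P * p * (ρ.toFun Q - (if Q = P then 1 else 0))

/-- Probabilistic transition sequence `μ →π ν` along a word `π`. -/
def PSeq : FinDist Tm → List (Act × ℝ) → FinDist Tm → Prop
  | μ, [], ν => ν = μ
  | μ, s :: π, ν => ∃ μ', PStep μ s.1 s.2 μ' ∧ PSeq μ' π ν

/-- Internal transition sequence `μ ⇝ ν`. -/
def Internal (μ ν : FinDist Tm) : Prop :=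
  ∃ π : List (Act × ℝ), (∀ s ∈ π, s.1 = Act.tau) ∧ PSeq μ π ν

/-! ## Observability predicates and testing characteristics -/

/-- `ψ_𝓛`: processes that can immediately perform an external action. -/
def psiL : Set Tm := {P | ∃ α ρ, Act.IsLabel α ∧ Step P α ρ}

/-- `ψ_ω`: processes that can immediately perform the success action `ω`. -/
def psiOmega : Set Tm := {P | ∃ ρ, Step P Act.omega ρ}

/-- The may characteristic `χmay_𝓛(μ) = sup { ν(ψ_𝓛) : μ ⇝ ν }`. -/
noncomputable def chiMayL (μ : FinDist Tm) : ℝ :=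
  sSup {x | ∃ ν, Internal μ ν ∧ x = ν.mass psiL}

/-- The fair characteristic `χfair_𝓛(μ) = inf { χmay_𝓛(ν) : μ ⇝ ν }`. -/
noncomputable def chiFairL (μ : FinDist Tm) : ℝ :=
  sInf {x | ∃ ν, Internal μ ν ∧ x = chiMayL ν}

/-- `χmay_ω(μ) = sup { ν(ψ_ω) : μ ⇝ ν }`. -/
noncomputable def chiMayOmega (μ : FinDist Tm) : ℝ :=
  sSup {x | ∃ ν, Internal μ ν ∧ x = ν.mass psiOmega}

/-- `χfair_ω(μ) = inf { χmay_ω(ν) : μ ⇝ ν }`. -/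
noncomputable def chiFairOmega (μ : FinDist Tm) : ℝ :=
  sInf {x | ∃ ν, Internal μ ν ∧ x = chiMayOmega ν}

/-! ## Testing contexts, equipollence, extensionality, diamond/box equivalences -/

/-- `Δ(P_CCS) ⊆ 𝒟 ⊆ D(P_RCCS)`, closed under parallel composition, localization
and (finite-domain) renaming. -/
structure IsTestingContext (D : Set (FinDist Tm)) : Prop where
  dirac_ccs : ∀ P : Tm, P.IsCCS → FinDist.dirac P ∈ D
  proc_dist : ∀ μ ∈ D, μ.IsProcDist
  closed_par : ∀ μ ∈ D, ∀ ν ∈ D, μ.parD ν ∈ D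
  closed_loc : ∀ μ ∈ D, ∀ L : Finset Chan, FinDist.locD L μ ∈ D
  closed_rename : ∀ μ ∈ D, ∀ f : Chan → Chan, {a | f a ≠ a}.Finite →
      FinDist.renameD f μ ∈ D

/-- `R` is probabilistically equipollent. -/
def Equipollent (R : FinDist Tm → FinDist Tm → Prop) : Prop :=
  ∀ μ1 μ2, R μ1 μ2 → chiMayL μ1 = chiMayL μ2

/-- `R` is probabilistically strongly equipollent. -/
def StronglyEquipollent (R : FinDist Tm → FinDist Tm → Prop) : Prop :=
  ∀ μ1 μ2, R μ1 μ2 → chiFairL μ1 = chiFairL μ2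

/-- `R` is `𝒟`-extensional. -/
def DExtensional (D : Set (FinDist Tm)) (R : FinDist Tm → FinDist Tm → Prop) : Prop :=
  ∀ μ1 μ2, R μ1 μ2 →
    (∀ ν ∈ D, R (μ1.parD ν) (μ2.parD ν)) ∧
    (∀ L : Finset Chan, R (FinDist.locD L μ1) (FinDist.locD L μ2))

/-- The `𝒟`-diamond equivalence `=◇^𝒟`, the largest probabilistically equipollent
`𝒟`-extensional relation. -/
def DiamondEq (D : Set (FinDist Tm)) (μ1 μ2 : FinDist Tm) : Prop :=
  ∃ R, Equipollent R ∧ DExtensional D R ∧ R μ1 μ2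

/-- The `𝒟`-box equivalence `=□^𝒟`, the largest probabilistically strongly
equipollent `𝒟`-extensional relation. -/
def BoxEq (D : Set (FinDist Tm)) (μ1 μ2 : FinDist Tm) : Prop :=
  ∃ R, StronglyEquipollent R ∧ DExtensional D R ∧ R μ1 μ2

/-! ## Probabilistic strong bisimulation and lifting -/

/-- Lifting of a relation on processes to distributions, matching the decomposition
`ρ1 = Σ_i p_i δ_{A_i}`, `ρ2 = Σ_i p_i δ_{B_i}` with `A_i R B_i`. -/
def RelLift (R : Tm → Tm → Prop) (ρ1 ρ2 : FinDist Tm) : Prop :=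
  ∃ (k : ℕ) (p : Fin (k+1) → ℝ) (A B : Fin (k+1) → Tm),
    (∀ i, 0 ≤ p i) ∧
    (∀ Q, ρ1.toFun Q = ∑ i, if A i = Q then p i else 0) ∧
    (∀ Q, ρ2.toFun Q = ∑ i, if B i = Q then p i else 0) ∧
    (∀ i, R (A i) (B i))

/-- `R` is a probabilistic strong bisimulation. -/
def IsStrongBisim (R : Tm → Tm → Prop) : Prop :=
  ∀ P Q, R P Q →
    (∀ α ρ, Step P α ρ → ∃ ρ', Step Q α ρ' ∧ RelLift R ρ ρ') ∧
    (∀ α ρ, Step Q α ρ → ∃ ρ', Step P α ρ' ∧ RelLift R ρ ρ')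

/-- `∼p`, the largest probabilistic strong bisimulation. -/
def StrongBisim (P Q : Tm) : Prop := ∃ R, IsStrongBisim R ∧ R P Q

/-- Lifting `E†` of an equivalence on processes to distributions: agreement on the
mass of every equivalence class. -/
def EqLift (E : Tm → Tm → Prop) (μ1 μ2 : FinDist Tm) : Prop :=
  ∀ P, μ1.mass {Q | E P Q} = μ2.mass {Q | E P Q}


namespace FinDist

/-- Expectation of a real function. -/
noncomputable def E {α : Type} (μ : FinDist α) (h : α → ℝ) : ℝ := ∑ᶠ a, μ.toFun a * h a

theorem E_eq_sum {α : Type} (μ : FinDist α) (h : α → ℝ) (s : Finset α)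
    (hs : ∀ a, μ.toFun a ≠ 0 → a ∈ s) : μ.E h = ∑ a ∈ s, μ.toFun a * h a := by
  apply finsum_eq_finsetSum_of_support_subset
  intro a ha
  exact hs a (left_ne_zero_of_mul ha)

/-- The support as a finset. -/
noncomputable def supp {α : Type} (μ : FinDist α) : Finset α := μ.finite_support.toFinset

theorem mem_supp {α : Type} {μ : FinDist α} {a : α} : a ∈ μ.supp ↔ μ.toFun a ≠ 0 := by
  simp [supp]

theorem E_supp {α : Type} (μ : FinDist α) (h : α → ℝ) :
    μ.E h = ∑ a ∈ μ.supp, μ.toFun a * h a :=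
  E_eq_sum μ h _ (fun _ => mem_supp.2)

theorem E_congr {α : Type} (μ : FinDist α) {h h' : α → ℝ}
    (H : ∀ a, μ.toFun a ≠ 0 → h a = h' a) : μ.E h = μ.E h' := by
  rw [E_supp, E_supp]
  exact Finset.sum_congr rfl fun a ha => by rw [H a (mem_supp.1 ha)]

theorem E_single {α : Type} (μ : FinDist α) (b : α) :
    μ.E (fun a => if a = b then 1 else 0) = μ.toFun b := by
  unfold E
  rw [finsum_eq_single _ b (fun a ha => by simp [ha])]
  simp

theorem E_one {α : Type} (μ : FinDist α) : μ.E (fun _ => 1) = 1 := by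
  unfold E
  simpa using μ.sum_one

theorem ext' {α : Type} {μ ν : FinDist α} (H : ∀ a, μ.toFun a = ν.toFun a) : μ = ν := by
  cases μ; cases ν
  congr
  exact funext H

theorem ext_E {α : Type} {μ ν : FinDist α} (H : ∀ h, μ.E h = ν.E h) : μ = ν :=
  ext' fun b => by rw [← E_single, H, E_single]

theorem mass_eq {α : Type} (μ : FinDist α) (φ : Set α) :
    μ.mass φ = μ.E (fun a => if a ∈ φ then 1 else 0) := by
  unfold mass E
  apply finsum_congr
  intro a
  by_cases h : a ∈ φ <;> simp [h]

theorem map_toFun {α β : Type} (g : α → β) (μ : FinDist α) (b : β) :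
    (μ.map g).toFun b = μ.E (fun a => if g a = b then 1 else 0) :=
  mass_eq μ {a | g a = b}

theorem map_ne_zero {α β : Type} {g : α → β} {μ : FinDist α} {b : β}
    (h : (μ.map g).toFun b ≠ 0) : ∃ a, μ.toFun a ≠ 0 ∧ g a = b := by
  rw [map_toFun, E_supp] at h
  obtain ⟨a, ha, h2⟩ := Finset.exists_ne_zero_of_sum_ne_zero h
  refine ⟨a, mem_supp.1 ha, ?_⟩
  by_contra h3
  simp [h3] at h2

theorem E_map {α β : Type} (g : α → β) (μ : FinDist α) (h : β → ℝ) :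
    (μ.map g).E h = μ.E (fun a => h (g a)) := by
  rw [E_eq_sum _ h (μ.supp.image g), E_supp]
  · simp_rw [map_toFun, E_supp, Finset.sum_mul]
    rw [Finset.sum_comm]
    refine Finset.sum_congr rfl fun a ha => ?_
    rw [Finset.sum_eq_single (g a)]
    · simp
    · intro b _ hb
      simp [hb.symm]
    · intro h1
      exact absurd (Finset.mem_image_of_mem g ha) h1
  · intro b hb
    obtain ⟨a, h1, h2⟩ := map_ne_zero hb
    exact Finset.mem_image.2 ⟨a, mem_supp.2 h1, h2⟩

theorem E_prod {α β : Type} (μ : FinDist α) (ν : FinDist β) (h : α × β → ℝ) :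
    (μ.prod ν).E h = μ.E (fun a => ν.E (fun b => h (a, b))) := by
  rw [E_eq_sum _ h (μ.supp ×ˢ ν.supp), Finset.sum_product, E_supp]
  · refine Finset.sum_congr rfl fun a _ => ?_
    rw [E_supp, Finset.mul_sum]
    exact Finset.sum_congr rfl fun b _ => by simp [prod, mul_assoc]
  · rintro ⟨a, b⟩ hb
    have := mul_ne_zero_iff.1 hb
    exact Finset.mem_product.2 ⟨mem_supp.2 this.1, mem_supp.2 this.2⟩

theorem prod_ne_zero {α β : Type} {μ : FinDist α} {ν : FinDist β} {x : α × β}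
    (h : (μ.prod ν).toFun x ≠ 0) : μ.toFun x.1 ≠ 0 ∧ ν.toFun x.2 ≠ 0 :=
  mul_ne_zero_iff.1 h

theorem E_comm {α β : Type} (μ : FinDist α) (ν : FinDist β) (h : α → β → ℝ) :
    μ.E (fun a => ν.E (fun b => h a b)) = ν.E (fun b => μ.E (fun a => h a b)) := by
  simp_rw [E_supp, Finset.mul_sum]
  rw [Finset.sum_comm]
  exact Finset.sum_congr rfl fun _ _ => Finset.sum_congr rfl fun _ _ => by ring

theorem E_dirac {α : Type} (P : α) (h : α → ℝ) : (dirac P).E h = h P := by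
  unfold E dirac
  rw [finsum_eq_single _ P (fun a ha => by simp [ha])]
  simp

theorem dirac_ne_zero {α : Type} {P Q : α} (h : (dirac P).toFun Q ≠ 0) : Q = P := by
  by_contra h2
  simp [dirac, h2] at h

theorem E_parD (μ ν : FinDist Tm) (h : Tm → ℝ) :
    (μ.parD ν).E h = μ.E (fun a => ν.E (fun b => h (.par a b))) := by
  rw [parD, E_map, E_prod]

theorem E_locD (L : Finset Chan) (μ : FinDist Tm) (h : Tm → ℝ) :
    (locD L μ).E h = μ.E (fun a => h (.loc L a)) := by
  rw [locD, E_map]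

theorem parD_ne_zero {μ ν : FinDist Tm} {P : Tm} (h : (μ.parD ν).toFun P ≠ 0) :
    ∃ A B, μ.toFun A ≠ 0 ∧ ν.toFun B ≠ 0 ∧ P = .par A B := by
  obtain ⟨x, h1, h2⟩ := map_ne_zero h
  exact ⟨x.1, x.2, (prod_ne_zero h1).1, (prod_ne_zero h1).2, h2.symm⟩

theorem locD_ne_zero {L : Finset Chan} {μ : FinDist Tm} {P : Tm}
    (h : (locD L μ).toFun P ≠ 0) : ∃ A, μ.toFun A ≠ 0 ∧ P = .loc L A := by
  obtain ⟨x, h1, h2⟩ := map_ne_zero h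
  exact ⟨x, h1, h2.symm⟩

/-- A finitely supported distribution from a weight function on a finite type. -/
noncomputable def ofFintype {ι : Type} [Fintype ι] (p : ι → ℝ) (h0 : ∀ i, 0 ≤ p i)
    (h1 : ∑ i, p i = 1) : FinDist ι where
  toFun := p
  nonneg := h0
  finite_support := Set.toFinite _
  sum_one := by rw [finsum_eq_sum_of_fintype, h1]

theorem E_fintype {ι : Type} [Fintype ι] (π : FinDist ι) (h : ι → ℝ) :
    π.E h = ∑ i, π.toFun i * h i := by
  unfold E; rw [finsum_eq_sum_of_fintype]

end FinDist

open FinDist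

/-- Couplings. -/
def Coup (R : Tm → Tm → Prop) (ρ1 ρ2 : FinDist Tm) : Prop :=
  ∃ γ : FinDist (Tm × Tm), γ.map Prod.fst = ρ1 ∧ γ.map Prod.snd = ρ2 ∧
    ∀ x, γ.toFun x ≠ 0 → R x.1 x.2

theorem Coup.of_E {α : Type} {R : Tm → Tm → Prop} {ρ1 ρ2 : FinDist Tm} (π : FinDist α)
    (f g : α → Tm) (h1 : ∀ h, ρ1.E h = π.E (fun a => h (f a)))
    (h2 : ∀ h, ρ2.E h = π.E (fun a => h (g a)))
    (hR : ∀ a, π.toFun a ≠ 0 → R (f a) (g a)) : Coup R ρ1 ρ2 := by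
  refine ⟨π.map (fun a => (f a, g a)), ?_, ?_, ?_⟩
  · exact ext_E fun h => by rw [E_map, E_map, h1]
  · exact ext_E fun h => by rw [E_map, E_map, h2]
  · intro x hx
    obtain ⟨a, ha, rfl⟩ := map_ne_zero hx
    exact hR a ha

theorem Coup.mono {R S : Tm → Tm → Prop} {ρ1 ρ2 : FinDist Tm} (h : Coup R ρ1 ρ2)
    (H : ∀ A B, ρ1.toFun A ≠ 0 → ρ2.toFun B ≠ 0 → R A B → S A B) : Coup S ρ1 ρ2 := by
  obtain ⟨γ, rfl, rfl, h3⟩ := h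
  have key : ∀ (g : Tm × Tm → Tm) x, γ.toFun x ≠ 0 → (γ.map g).toFun (g x) ≠ 0 := by
    intro g x hx
    rw [map_toFun, E_supp]
    apply ne_of_gt
    apply Finset.sum_pos' (fun i _ => mul_nonneg (γ.nonneg i) (by split_ifs <;> norm_num))
    exact ⟨x, mem_supp.2 hx, by simpa using lt_of_le_of_ne (γ.nonneg x) hx.symm⟩
  exact ⟨γ, rfl, rfl, fun x hx => H _ _ (key _ x hx) (key _ x hx) (h3 x hx)⟩

theorem Coup.symm {R S : Tm → Tm → Prop} {ρ1 ρ2 : FinDist Tm} (h : Coup R ρ1 ρ2)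
    (H : ∀ A B, R A B → S B A) : Coup S ρ2 ρ1 := by
  obtain ⟨γ, rfl, rfl, h3⟩ := h
  exact Coup.of_E γ Prod.snd Prod.fst (fun h => E_map _ _ _) (fun h => E_map _ _ _)
    fun x hx => H _ _ (h3 x hx)

theorem Coup.refl {R : Tm → Tm → Prop} (hR : ∀ A, R A A) (ρ : FinDist Tm) : Coup R ρ ρ :=
  Coup.of_E ρ id id (fun _ => rfl) (fun _ => rfl) fun _ _ => hR _

theorem coup_dirac {R : Tm → Tm → Prop} {A B : Tm} (h : R A B) :
    Coup R (dirac A) (dirac B) :=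
  Coup.of_E (dirac ()) (fun _ => A) (fun _ => B)
    (fun h => by rw [E_dirac, E_dirac]) (fun h => by rw [E_dirac, E_dirac]) fun _ _ => h

theorem Coup.E_eq {R : Tm → Tm → Prop} {ρ1 ρ2 : FinDist Tm} (hc : Coup R ρ1 ρ2)
    (h : Tm → ℝ) (H : ∀ A B, R A B → h A = h B) : ρ1.E h = ρ2.E h := by
  obtain ⟨γ, rfl, rfl, h3⟩ := hc
  rw [E_map, E_map]
  exact E_congr _ fun x hx => H _ _ (h3 x hx)

theorem Coup.par {R S U : Tm → Tm → Prop} {ρ1 ρ2 σ1 σ2 : FinDist Tm} (h : Coup R ρ1 ρ2)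
    (k : Coup S σ1 σ2) (H : ∀ A B C D, R A B → S C D → U (.par A C) (.par B D)) :
    Coup U (ρ1.parD σ1) (ρ2.parD σ2) := by
  obtain ⟨γ, rfl, rfl, h3⟩ := h
  obtain ⟨κ, rfl, rfl, k3⟩ := k
  refine Coup.of_E (γ.prod κ) (fun x => .par x.1.1 x.2.1) (fun x => .par x.1.2 x.2.2) ?_ ?_ ?_
  · intro h; simp only [E_parD, E_map, E_prod]
  · intro h; simp only [E_parD, E_map, E_prod]
  · intro x hx
    have := prod_ne_zero hx
    exact H _ _ _ _ (h3 _ this.1) (k3 _ this.2)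

theorem Coup.loc {R U : Tm → Tm → Prop} {ρ1 ρ2 : FinDist Tm} (L : Finset Chan)
    (h : Coup R ρ1 ρ2) (H : ∀ A B, R A B → U (.loc L A) (.loc L B)) :
    Coup U (locD L ρ1) (locD L ρ2) := by
  obtain ⟨γ, rfl, rfl, h3⟩ := h
  refine Coup.of_E γ (fun x => .loc L x.1) (fun x => .loc L x.2) ?_ ?_ ?_
  · intro h; simp only [E_locD, E_map]
  · intro h; simp only [E_locD, E_map]
  · intro x hx
    exact H _ _ (h3 _ hx)

theorem E_of_decomp {k : ℕ} {p : Fin (k+1) → ℝ} {A : Fin (k+1) → Tm} {ρ : FinDist Tm}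
    (h : ∀ Q, ρ.toFun Q = ∑ i, if A i = Q then p i else 0) (f : Tm → ℝ) :
    ρ.E f = ∑ i, p i * f (A i) := by
  rw [E_eq_sum ρ f (ρ.supp ∪ Finset.univ.image A)
    (fun a ha => Finset.mem_union_left _ (mem_supp.2 ha))]
  simp_rw [h, Finset.sum_mul]
  rw [Finset.sum_comm]
  refine Finset.sum_congr rfl fun i _ => ?_
  rw [Finset.sum_eq_single (A i)]
  · simp
  · intro b _ hb
    simp [hb.symm]
  · intro hn
    exact absurd (Finset.mem_union_right _ (Finset.mem_image_of_mem A (Finset.mem_univ i))) hn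

theorem coup_of_decomp {R : Tm → Tm → Prop} {ρ1 ρ2 : FinDist Tm} {k : ℕ}
    {p : Fin (k+1) → ℝ} {A B : Fin (k+1) → Tm} (h0 : ∀ i, 0 ≤ p i)
    (h1 : ∀ Q, ρ1.toFun Q = ∑ i, if A i = Q then p i else 0)
    (h2 : ∀ Q, ρ2.toFun Q = ∑ i, if B i = Q then p i else 0)
    (hR : ∀ i, R (A i) (B i)) : Coup R ρ1 ρ2 := by
  have hs : ∑ i, p i = 1 := by
    have := E_of_decomp h1 (fun _ => 1)
    rw [E_one] at this
    simpa using this.symm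
  refine Coup.of_E (ofFintype p h0 hs) A B ?_ ?_ fun i _ => hR i
  · intro h; rw [E_of_decomp h1, E_fintype]; rfl
  · intro h; rw [E_of_decomp h2, E_fintype]; rfl

theorem RelLift.coup {R : Tm → Tm → Prop} {ρ1 ρ2 : FinDist Tm} (h : RelLift R ρ1 ρ2) :
    Coup R ρ1 ρ2 := by
  obtain ⟨k, p, A, B, h0, h1, h2, hR⟩ := h
  exact coup_of_decomp h0 h1 h2 hR

theorem Coup.relLift {R : Tm → Tm → Prop} {ρ1 ρ2 : FinDist Tm} (h : Coup R ρ1 ρ2) :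
    RelLift R ρ1 ρ2 := by
  obtain ⟨γ, rfl, rfl, h3⟩ := h
  have hne : γ.supp.Nonempty := by
    by_contra hc
    rw [Finset.not_nonempty_iff_eq_empty] at hc
    have := E_one γ
    rw [E_supp, hc] at this
    simp at this
  obtain ⟨k, hk⟩ : ∃ k, γ.supp.card = k + 1 :=
    ⟨γ.supp.card - 1, by have := Finset.card_pos.2 hne; omega⟩
  let e : γ.supp ≃ Fin (k+1) := γ.supp.equivFinOfCardEq hk
  have key : ∀ f : Tm × Tm → ℝ, γ.E f = ∑ i, γ.toFun (e.symm i) * f (e.symm i) := by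
    intro f
    rw [E_supp, ← Finset.sum_coe_sort, ← Equiv.sum_comp e.symm]
  refine ⟨k, fun i => γ.toFun (e.symm i), fun i => (e.symm i).1.1, fun i => (e.symm i).1.2,
    fun i => γ.nonneg _, ?_, ?_, ?_⟩
  · intro Q
    rw [map_toFun, key]
    simp
  · intro Q
    rw [map_toFun, key]
    simp
  · intro i
    exact h3 _ (mem_supp.1 (e.symm i).2)

theorem sb_of_sim (R : Tm → Tm → Prop) (hs : ∀ P Q, R P Q → R Q P)
    (hf : ∀ P Q, R P Q → ∀ α ρ, Step P α ρ → ∃ ρ', Step Q α ρ' ∧ Coup R ρ ρ')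
    {P Q : Tm} (h : R P Q) : StrongBisim P Q := by
  have key : ∀ P Q, R P Q → ∀ α ρ, Step P α ρ → ∃ ρ', Step Q α ρ' ∧ RelLift R ρ ρ' := by
    intro P Q h α ρ hst
    obtain ⟨ρ', h1, h2⟩ := hf P Q h α ρ hst
    exact ⟨ρ', h1, h2.relLift⟩
  exact ⟨R, fun P Q h => ⟨key P Q h, key Q P (hs P Q h)⟩, h⟩

theorem sb_of_bisim (R : Tm → Tm → Prop)
    (hf : ∀ P Q, R P Q → ∀ α ρ, Step P α ρ → ∃ ρ', Step Q α ρ' ∧ Coup R ρ ρ')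
    (hb : ∀ P Q, R P Q → ∀ α ρ', Step Q α ρ' → ∃ ρ, Step P α ρ ∧ Coup R ρ ρ')
    {P Q : Tm} (h : R P Q) : StrongBisim P Q := by
  refine sb_of_sim (fun A B => R A B ∨ R B A) (fun _ _ h => h.symm) ?_ (Or.inl h)
  rintro P Q (h | h) α ρ hst
  · obtain ⟨ρ', h1, h2⟩ := hf P Q h α ρ hst
    exact ⟨ρ', h1, h2.mono fun _ _ _ _ => Or.inl⟩
  · obtain ⟨ρ', h1, h2⟩ := hb Q P h α ρ hst
    exact ⟨ρ', h1, h2.symm fun _ _ => Or.inr⟩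

theorem StrongBisim.fwd {P Q : Tm} (h : StrongBisim P Q) {α : Act} {ρ : FinDist Tm}
    (hst : Step P α ρ) : ∃ ρ', Step Q α ρ' ∧ Coup StrongBisim ρ ρ' := by
  obtain ⟨R, hR, hPQ⟩ := h
  obtain ⟨ρ', h1, h2⟩ := (hR P Q hPQ).1 α ρ hst
  exact ⟨ρ', h1, h2.coup.mono fun _ _ _ _ hab => ⟨R, hR, hab⟩⟩

theorem StrongBisim.symm {P Q : Tm} (h : StrongBisim P Q) : StrongBisim Q P := by
  obtain ⟨R, hR, hPQ⟩ := h
  refine sb_of_sim (fun A B => R A B ∨ R B A) (fun _ _ h => h.symm) ?_ (Or.inr hPQ)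
  rintro P Q (h | h) α ρ hst
  · obtain ⟨ρ', h1, h2⟩ := (hR P Q h).1 α ρ hst
    exact ⟨ρ', h1, h2.coup.mono fun _ _ _ _ => Or.inl⟩
  · obtain ⟨ρ', h1, h2⟩ := (hR Q P h).2 α ρ hst
    exact ⟨ρ', h1, h2.coup.mono fun _ _ _ _ => Or.inl⟩

theorem StrongBisim.refl (P : Tm) : StrongBisim P P :=
  sb_of_sim (fun A B => A = B) (fun _ _ h => h.symm)
    (by rintro P Q rfl α ρ h; exact ⟨ρ, h, Coup.refl (fun _ => rfl) ρ⟩) rfl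

theorem Coup.eqLift {R : Tm → Tm → Prop} {ρ1 ρ2 : FinDist Tm} (hc : Coup R ρ1 ρ2)
    {E : Tm → Tm → Prop} (hE : Equivalence E) (hRE : ∀ A B, R A B → E A B) :
    EqLift E ρ1 ρ2 := by
  intro P
  rw [mass_eq, mass_eq]
  refine hc.E_eq _ fun A B h => ?_
  have : A ∈ {Q | E P Q} ↔ B ∈ {Q | E P Q} :=
    ⟨fun h1 => hE.trans h1 (hRE _ _ h), fun h1 => hE.trans h1 (hE.symm (hRE _ _ h))⟩
  simp only [this]

theorem EqLift.coup {ρ1 ρ2 : FinDist Tm} {E : Tm → Tm → Prop} (hE : Equivalence E)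
    (h : EqLift E ρ1 ρ2) : Coup E ρ1 ρ2 := by
  let g : Tm × Tm → ℝ := fun x =>
    if E x.1 x.2 then ρ1.toFun x.1 * ρ2.toFun x.2 / ρ1.mass {Q | E x.1 Q} else 0
  have hm : ∀ (ρ : FinDist Tm) a, ρ.mass {Q | E a Q}
      = ∑ b ∈ ρ.supp, if E a b then ρ.toFun b else 0 := by
    intro ρ a
    rw [mass_eq, E_supp]
    refine Finset.sum_congr rfl fun b _ => ?_
    simp
  have hpos : ∀ (ρ : FinDist Tm) a, ρ.toFun a ≠ 0 → 0 < ρ.mass {Q | E a Q} := by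
    intro ρ a ha
    rw [hm]
    refine Finset.sum_pos' (fun i _ => ?_) ⟨a, mem_supp.2 ha, ?_⟩
    · split_ifs
      · exact ρ.nonneg i
      · exact le_rfl
    · rw [if_pos (hE.refl a)]
      exact lt_of_le_of_ne (ρ.nonneg a) ha.symm
  have hrow : ∀ a, ρ1.toFun a ≠ 0 → ∑ b ∈ ρ2.supp, g (a, b) = ρ1.toFun a := by
    intro a ha
    have h1 : ∀ b ∈ ρ2.supp, g (a, b)
        = ρ1.toFun a / ρ1.mass {Q | E a Q} * (if E a b then ρ2.toFun b else 0) := by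
      intro b _
      simp only [g]
      split_ifs <;> ring
    rw [Finset.sum_congr rfl h1, ← Finset.mul_sum, ← hm, ← h a,
      div_mul_cancel₀ _ (hpos _ a ha).ne']
  have hcol : ∀ b, ρ2.toFun b ≠ 0 → ∑ a ∈ ρ1.supp, g (a, b) = ρ2.toFun b := by
    intro b hb
    have h1 : ∀ a ∈ ρ1.supp, g (a, b)
        = ρ2.toFun b / ρ1.mass {Q | E b Q} * (if E b a then ρ1.toFun a else 0) := by
      intro a _
      simp only [g]
      by_cases hab : E a b
      · have hs : {Q | E a Q} = {Q | E b Q} := by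
          ext Q
          exact ⟨fun h => hE.trans (hE.symm hab) h, fun h => hE.trans hab h⟩
        rw [if_pos hab, if_pos (hE.symm hab), hs]
        ring
      · rw [if_neg hab, if_neg fun h => hab (hE.symm h)]
        ring
    have hp := (hpos _ b hb).ne'
    rw [← h b] at hp
    rw [Finset.sum_congr rfl h1, ← Finset.mul_sum, ← hm, div_mul_cancel₀ _ hp]
  have hsub : ∀ x, g x ≠ 0 → x ∈ ρ1.supp ×ˢ ρ2.supp := by
    intro x hx
    simp only [g] at hx
    split_ifs at hx with hx'
    · have h1 := left_ne_zero_of_mul (left_ne_zero_of_mul hx)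
      have h2 := right_ne_zero_of_mul (left_ne_zero_of_mul hx)
      exact Finset.mem_product.2 ⟨mem_supp.2 h1, mem_supp.2 h2⟩
    · exact absurd rfl hx
  let γ : FinDist (Tm × Tm) :=
    { toFun := g
      nonneg := by
        intro x
        simp only [g]
        split_ifs
        · refine div_nonneg (mul_nonneg (ρ1.nonneg _) (ρ2.nonneg _)) ?_
          rw [hm]
          refine Finset.sum_nonneg fun i _ => ?_
          split_ifs
          · exact ρ1.nonneg i
          · exact le_rfl
        · exact le_rfl
      finite_support := (ρ1.supp ×ˢ ρ2.supp).finite_toSet.subset fun x hx => hsub x hx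
      sum_one := by
        rw [finsum_eq_finsetSum_of_support_subset g (s := ρ1.supp ×ˢ ρ2.supp)
          (fun x hx => hsub x hx), Finset.sum_product,
          Finset.sum_congr rfl fun a ha => hrow a (mem_supp.1 ha)]
        have := E_one ρ1
        rw [E_supp] at this
        simpa using this }
  refine ⟨γ, ?_, ?_, ?_⟩
  · refine ext_E fun f => ?_
    rw [E_map, E_eq_sum γ _ _ hsub, Finset.sum_product, E_supp]
    refine Finset.sum_congr rfl fun a ha => ?_
    rw [← hrow a (mem_supp.1 ha), Finset.sum_mul]
  · refine ext_E fun f => ?_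
    rw [E_map, E_eq_sum γ _ _ hsub, Finset.sum_product_right, E_supp]
    refine Finset.sum_congr rfl fun a ha => ?_
    rw [← hcol a (mem_supp.1 ha), Finset.sum_mul]
  · intro x hx
    change g x ≠ 0 at hx
    simp only [g] at hx
    by_contra hc
    exact hx (if_neg hc)

theorem StrongBisim.equivalence : Equivalence StrongBisim := by
  refine ⟨StrongBisim.refl, StrongBisim.symm, ?_⟩
  intro P Q A h1 h2
  have hE : Equivalence (Relation.EqvGen StrongBisim) := Relation.EqvGen.is_equivalence _
  have key : ∀ P Q, Relation.EqvGen StrongBisim P Q →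
      (∀ α ρ, Step P α ρ → ∃ ρ', Step Q α ρ' ∧ EqLift (Relation.EqvGen StrongBisim) ρ ρ') ∧
      (∀ α ρ, Step Q α ρ → ∃ ρ', Step P α ρ' ∧ EqLift (Relation.EqvGen StrongBisim) ρ ρ') := by
    intro P Q h
    induction h with
    | rel x y h =>
      constructor
      · intro α ρ hst
        obtain ⟨ρ', h1, h2⟩ := h.fwd hst
        exact ⟨ρ', h1, h2.eqLift hE Relation.EqvGen.rel⟩
      · intro α ρ hst
        obtain ⟨ρ', h1, h2⟩ := h.symm.fwd hst
        exact ⟨ρ', h1, h2.eqLift hE Relation.EqvGen.rel⟩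
    | refl x => exact ⟨fun α ρ h => ⟨ρ, h, fun _ => rfl⟩, fun α ρ h => ⟨ρ, h, fun _ => rfl⟩⟩
    | symm x y _ ih => exact ⟨ih.2, ih.1⟩
    | trans x y z _ _ ih1 ih2 =>
      constructor
      · intro α ρ hst
        obtain ⟨ρ', h1, h2⟩ := ih1.1 α ρ hst
        obtain ⟨ρ'', h3, h4⟩ := ih2.1 α ρ' h1
        exact ⟨ρ'', h3, fun P => (h2 P).trans (h4 P)⟩
      · intro α ρ hst
        obtain ⟨ρ', h1, h2⟩ := ih2.2 α ρ hst
        obtain ⟨ρ'', h3, h4⟩ := ih1.2 α ρ' h1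
        exact ⟨ρ'', h3, fun P => (h2 P).trans (h4 P)⟩
  refine sb_of_sim (Relation.EqvGen StrongBisim) (fun _ _ => hE.symm) ?_
    (hE.trans (Relation.EqvGen.rel _ _ h1) (Relation.EqvGen.rel _ _ h2))
  intro P Q h α ρ hst
  obtain ⟨ρ', h1, h2⟩ := (key P Q h).1 α ρ hst
  exact ⟨ρ', h1, h2.coup hE⟩

/-! Part 1 -/

theorem Act.Comp.symm {a b : Act} (h : Act.Comp a b) : Act.Comp b a := by
  obtain ⟨c, h | h⟩ := h
  · exact ⟨c, Or.inr ⟨h.2, h.1⟩⟩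
  · exact ⟨c, Or.inl ⟨h.2, h.1⟩⟩

theorem Act.Comp.chans {a b : Act} (h : Act.Comp a b) : a.chans = b.chans := by
  obtain ⟨c, ⟨rfl, rfl⟩ | ⟨rfl, rfl⟩⟩ := h <;> rfl

theorem Act.allowed_iff (L : Finset Chan) (a : Act) : a.Allowed L ↔ Disjoint L a.chans := by
  cases a <;> simp [Act.Allowed, Act.chans]

theorem coup_comm (ρ σ : FinDist Tm) :
    Coup (fun A B => ∃ P Q, A = .par P Q ∧ B = .par Q P) (ρ.parD σ) (σ.parD ρ) :=
  Coup.of_E (ρ.prod σ) (fun x => .par x.1 x.2) (fun x => .par x.2 x.1)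
    (fun h => by rw [E_parD, E_prod])
    (fun h => by rw [E_parD, E_prod, E_comm])
    fun x _ => ⟨_, _, rfl, rfl⟩

theorem sb_par_comm (P Q : Tm) : StrongBisim (.par P Q) (.par Q P) := by
  refine sb_of_sim (fun A B => ∃ P Q, A = .par P Q ∧ B = .par Q P) ?_ ?_ ⟨P, Q, rfl, rfl⟩
  · rintro _ _ ⟨P, Q, rfl, rfl⟩
    exact ⟨_, _, rfl, rfl⟩
  · rintro _ _ ⟨P, Q, rfl, rfl⟩ α ρ h
    cases h with
    | parL _ h => exact ⟨_, Step.parR _ h, coup_comm _ _⟩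
    | parR _ h => exact ⟨_, Step.parL _ h, coup_comm _ _⟩
    | comm hc h1 h2 => exact ⟨_, Step.comm hc.symm h2 h1, coup_comm _ _⟩

theorem sb_par_nil (P : Tm) : StrongBisim (.par P .nil) P := by
  have key : ∀ ρ : FinDist Tm,
      Coup (fun A B => A = .par B .nil) (ρ.parD (dirac .nil)) ρ := fun ρ =>
    Coup.of_E ρ (fun x => .par x .nil) (fun x => x)
      (fun h => by simp only [E_parD, E_dirac]) (fun h => rfl) fun x _ => rfl
  refine sb_of_bisim (fun A B => A = .par B .nil) ?_ ?_ rfl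
  · rintro _ P rfl α ρ h
    cases h with
    | parL _ h => exact ⟨_, h, key _⟩
    | parR _ h => cases h
    | comm hc h1 h2 => cases h2
  · rintro _ P rfl α ρ h
    exact ⟨_, Step.parL _ h, key _⟩

theorem coup_assoc (ρ σ π : FinDist Tm) :
    Coup (fun A B => ∃ P Q R, A = .par (.par P Q) R ∧ B = .par P (.par Q R))
      ((ρ.parD σ).parD π) (ρ.parD (σ.parD π)) :=
  Coup.of_E (ρ.prod (σ.prod π)) (fun x => .par (.par x.1 x.2.1) x.2.2)
    (fun x => .par x.1 (.par x.2.1 x.2.2))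
    (fun h => by simp only [E_parD, E_prod])
    (fun h => by simp only [E_parD, E_prod])
    fun x _ => ⟨_, _, _, rfl, rfl⟩

theorem parD_dirac (P Q : Tm) : (dirac P).parD (dirac Q) = dirac (.par P Q) :=
  ext_E fun h => by simp only [E_parD, E_dirac]

theorem locD_dirac (L : Finset Chan) (P : Tm) : locD L (dirac P) = dirac (.loc L P) :=
  ext_E fun h => by simp only [E_locD, E_dirac]

theorem sb_par_assoc (P Q A : Tm) :
    StrongBisim (.par (.par P Q) A) (.par P (.par Q A)) := by
  refine sb_of_bisim (fun A B => ∃ P Q R, A = .par (.par P Q) R ∧ B = .par P (.par Q R))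
    ?_ ?_ ⟨P, Q, A, rfl, rfl⟩
  · rintro _ _ ⟨P, Q, A, rfl, rfl⟩ α ρ h
    cases h with
    | parL _ h =>
      cases h with
      | parL _ h =>
        exact ⟨_, Step.parL _ h, by rw [← parD_dirac]; exact coup_assoc _ _ _⟩
      | parR _ h => exact ⟨_, Step.parR _ (Step.parL _ h), coup_assoc _ _ _⟩
      | comm hc h1 h2 => exact ⟨_, Step.comm hc h1 (Step.parL _ h2), coup_assoc _ _ _⟩
    | parR _ h =>
      exact ⟨_, Step.parR _ (Step.parR _ h), by rw [← parD_dirac]; exact coup_assoc _ _ _⟩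
    | comm hc h1 h2 =>
      cases h1 with
      | parL _ h => exact ⟨_, Step.comm hc h (Step.parR _ h2), coup_assoc _ _ _⟩
      | parR _ h => exact ⟨_, Step.parR _ (Step.comm hc h h2), coup_assoc _ _ _⟩
      | comm hc' h1 h2 => obtain ⟨c, h | h⟩ := hc <;> cases h.1
  · rintro _ _ ⟨P, Q, A, rfl, rfl⟩ α ρ h
    cases h with
    | parL _ h =>
      exact ⟨_, Step.parL _ (Step.parL _ h), by rw [← parD_dirac]; exact coup_assoc _ _ _⟩
    | parR _ h =>
      cases h with
      | parL _ h => exact ⟨_, Step.parL _ (Step.parR _ h), coup_assoc _ _ _⟩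
      | parR _ h =>
        exact ⟨_, Step.parR _ h, by rw [← parD_dirac]; exact coup_assoc _ _ _⟩
      | comm hc h1 h2 => exact ⟨_, Step.comm hc (Step.parR _ h1) h2, coup_assoc _ _ _⟩
    | comm hc h1 h2 =>
      cases h2 with
      | parL _ h => exact ⟨_, Step.parL _ (Step.comm hc h1 h), coup_assoc _ _ _⟩
      | parR _ h => exact ⟨_, Step.comm hc (Step.parL _ h1) h, coup_assoc _ _ _⟩
      | comm hc' h1 h2 => obtain ⟨c, h | h⟩ := hc <;> cases h.2

theorem sb_fix (T : Tm) : StrongBisim (.fix T) (Tm.subst (.fix T) 0 T) := by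
  refine sb_of_bisim (fun A B => A = B ∨ ∃ T, A = .fix T ∧ B = Tm.subst (.fix T) 0 T)
    ?_ ?_ (Or.inr ⟨T, rfl, rfl⟩)
  · rintro P Q (rfl | ⟨T, rfl, rfl⟩) α ρ h
    · exact ⟨ρ, h, Coup.refl (fun _ => Or.inl rfl) _⟩
    · cases h with
      | fixp h => exact ⟨ρ, h, Coup.refl (fun _ => Or.inl rfl) _⟩
  · rintro P Q (rfl | ⟨T, rfl, rfl⟩) α ρ h
    · exact ⟨ρ, h, Coup.refl (fun _ => Or.inl rfl) _⟩
    · exact ⟨ρ, Step.fixp h, Coup.refl (fun _ => Or.inl rfl) _⟩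

/-! Part 2 -/

theorem chans_subst (P : Tm) (T : Tm) : ∀ n, (Tm.subst P n T).chans ⊆ T.chans ∪ P.chans := by
  induction T with
  | nil => intro n; simp [Tm.subst, Tm.chans]
  | var m =>
    intro n
    simp only [Tm.subst]
    split_ifs <;> simp [Tm.chans]
  | sum k a c ih =>
    intro n x hx
    simp only [Tm.subst, Tm.chans, Finset.mem_union, Finset.mem_sup, Finset.mem_univ,
      true_and] at hx ⊢
    rcases hx with hx | ⟨i, hx⟩
    · exact Or.inl (Or.inl hx)
    · rcases Finset.mem_union.1 (ih i n hx) with h | h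
      · exact Or.inl (Or.inr ⟨i, h⟩)
      · exact Or.inr h
  | oplus k a c ih =>
    intro n x hx
    simp only [Tm.subst, Tm.chans, Finset.mem_union, Finset.mem_sup, Finset.mem_univ,
      true_and] at hx ⊢
    rcases hx with ⟨i, hx⟩
    · rcases Finset.mem_union.1 (ih i n hx) with h | h
      · exact Or.inl ⟨i, h⟩
      · exact Or.inr h
  | par S T ih1 ih2 =>
    intro n x hx
    have h1 := @ih1 n x
    have h2 := @ih2 n x
    simp only [Tm.subst, Tm.chans, Finset.mem_union] at *
    tauto
  | loc L T ih =>
    intro n x hx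
    have h1 := @ih n x
    simp only [Tm.subst, Tm.chans, Finset.mem_union] at *
    tauto
  | fix T ih =>
    intro n
    simp only [Tm.subst, Tm.chans]
    exact ih (n+1)

theorem oplus_ne_zero {k : ℕ} {w : Fin (k+1) → ℝ} {c : Fin (k+1) → Tm} {ρ : FinDist Tm}
    (h : ∀ Q, ρ.toFun Q = ∑ i, if c i = Q then w i else 0) {Q : Tm} (hQ : ρ.toFun Q ≠ 0) :
    ∃ i, c i = Q := by
  rw [h] at hQ
  obtain ⟨i, _, h2⟩ := Finset.exists_ne_zero_of_sum_ne_zero hQ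
  refine ⟨i, ?_⟩
  by_contra hc
  exact h2 (if_neg hc)

theorem step_chans {P : Tm} {α : Act} {ρ : FinDist Tm} (h : Step P α ρ) :
    α.chans ⊆ P.chans ∧ ∀ Q, ρ.toFun Q ≠ 0 → Q.chans ⊆ P.chans := by
  induction h with
  | choice a c i =>
    constructor
    · exact (Finset.le_sup (f := fun i => (a i).chans) (Finset.mem_univ i)).trans
        Finset.subset_union_left
    · intro Q hQ
      rw [dirac_ne_zero hQ]
      exact (Finset.le_sup (f := fun i => (c i).chans) (Finset.mem_univ i)).trans
        Finset.subset_union_right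
  | oplus w c ρ hw hρ =>
    refine ⟨by simp [Act.chans], fun Q hQ => ?_⟩
    obtain ⟨i, rfl⟩ := oplus_ne_zero hρ hQ
    exact Finset.le_sup (f := fun i => (c i).chans) (Finset.mem_univ i)
  | parL T h ih =>
    refine ⟨ih.1.trans Finset.subset_union_left, fun Q hQ => ?_⟩
    obtain ⟨A, B, hA, hB, rfl⟩ := parD_ne_zero hQ
    rw [dirac_ne_zero hB]
    exact Finset.union_subset_union (ih.2 _ hA) subset_rfl
  | parR T h ih =>
    refine ⟨ih.1.trans Finset.subset_union_right, fun Q hQ => ?_⟩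
    obtain ⟨A, B, hA, hB, rfl⟩ := parD_ne_zero hQ
    rw [dirac_ne_zero hA]
    exact Finset.union_subset_union subset_rfl (ih.2 _ hB)
  | comm hc h1 h2 ih1 ih2 =>
    refine ⟨by simp [Act.chans], fun Q hQ => ?_⟩
    obtain ⟨A, B, hA, hB, rfl⟩ := parD_ne_zero hQ
    exact Finset.union_subset_union (ih1.2 _ hA) (ih2.2 _ hB)
  | loc L h ha ih =>
    refine ⟨ih.1.trans Finset.subset_union_right, fun Q hQ => ?_⟩
    obtain ⟨A, hA, rfl⟩ := locD_ne_zero hQ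
    exact Finset.union_subset_union subset_rfl (ih.2 _ hA)
  | @fixp T β ρ h ih =>
    have : (Tm.subst (.fix T) 0 T).chans ⊆ (Tm.fix T).chans := by
      refine (chans_subst _ _ _).trans ?_
      simp [Tm.chans]
    exact ⟨ih.1.trans this, fun Q hQ => (ih.2 Q hQ).trans this⟩

theorem sb_loc (L : Finset Chan) (Q : Tm) (hQ : Disjoint L Q.chans) :
    StrongBisim (.loc L Q) Q := by
  have key : ∀ (P : Tm) (α : Act) (ρ : FinDist Tm), Disjoint L P.chans → Step P α ρ →
      Coup (fun A B => A = .loc L B ∧ Disjoint L B.chans) (locD L ρ) ρ := fun P α ρ hP hs =>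
    Coup.of_E ρ (fun x => .loc L x) (fun x => x)
      (fun h => by simp only [E_locD]) (fun h => rfl)
      fun x hx => ⟨rfl, hP.mono_right ((step_chans hs).2 x hx)⟩
  refine sb_of_bisim (fun A B => A = .loc L B ∧ Disjoint L B.chans) ?_ ?_ ⟨rfl, hQ⟩
  · rintro _ P ⟨rfl, hP⟩ α ρ h
    cases h with
    | loc _ h ha => exact ⟨_, h, key _ _ _ hP h⟩
  · rintro _ P ⟨rfl, hP⟩ α ρ h
    exact ⟨_, Step.loc L h ((Act.allowed_iff _ _).2 (hP.mono_right (step_chans h).1)),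
      key _ _ _ hP h⟩

theorem sb_loc_par (L : Finset Chan) (P Q : Tm) (hQ : Disjoint L Q.chans) :
    StrongBisim (.par (.loc L P) Q) (.loc L (.par P Q)) := by
  have key : ∀ (ρ σ : FinDist Tm), (∀ Q, σ.toFun Q ≠ 0 → Disjoint L Q.chans) →
      Coup (fun A B => ∃ P Q, Disjoint L Q.chans ∧ A = .par (.loc L P) Q ∧
        B = .loc L (.par P Q)) ((locD L ρ).parD σ) (locD L (ρ.parD σ)) := fun ρ σ hσ =>
    Coup.of_E (ρ.prod σ) (fun x => .par (.loc L x.1) x.2) (fun x => .loc L (.par x.1 x.2))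
      (fun h => by simp only [E_locD, E_parD, E_prod])
      (fun h => by simp only [E_locD, E_parD, E_prod])
      fun x hx => ⟨_, _, hσ _ (prod_ne_zero hx).2, rfl, rfl⟩
  have hd : ∀ Q : Tm, Disjoint L Q.chans → ∀ Q' : Tm, (dirac Q).toFun Q' ≠ 0 → Disjoint L Q'.chans := by
    intro Q hQ Q' h
    rwa [dirac_ne_zero h]
  have hs : ∀ (Q : Tm) (α : Act) (ρ : FinDist Tm), Disjoint L Q.chans → Step Q α ρ →
      α.Allowed L ∧ ∀ Q', ρ.toFun Q' ≠ 0 → Disjoint L Q'.chans := by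
    intro Q α ρ hQ h
    exact ⟨(Act.allowed_iff _ _).2 (hQ.mono_right (step_chans h).1),
      fun Q' h' => hQ.mono_right ((step_chans h).2 Q' h')⟩
  refine sb_of_bisim (fun A B => ∃ P Q, Disjoint L Q.chans ∧ A = .par (.loc L P) Q ∧
        B = .loc L (.par P Q)) ?_ ?_ ⟨P, Q, hQ, rfl, rfl⟩
  · rintro _ _ ⟨P, Q, hQ, rfl, rfl⟩ α ρ h
    cases h with
    | parL _ h =>
      cases h with
      | loc _ h ha => exact ⟨_, Step.loc L (Step.parL _ h) ha, key _ _ (hd _ hQ)⟩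
    | parR _ h =>
      have := hs _ _ _ hQ h
      exact ⟨_, Step.loc L (Step.parR _ h) this.1, by
        rw [← locD_dirac]; exact key _ _ this.2⟩
    | comm hc h1 h2 =>
      cases h1 with
      | loc _ h ha =>
        exact ⟨_, Step.loc L (Step.comm hc h h2) trivial, key _ _ (hs _ _ _ hQ h2).2⟩
  · rintro _ _ ⟨P, Q, hQ, rfl, rfl⟩ α ρ h
    cases h with
    | loc _ h ha =>
      cases h with
      | parL _ h => exact ⟨_, Step.parL _ (Step.loc L h ha), key _ _ (hd _ hQ)⟩
      | parR _ h => exact ⟨_, Step.parR _ h, by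
        rw [← locD_dirac]; exact key _ _ (hs _ _ _ hQ h).2⟩
      | comm hc h1 h2 =>
        have := hs _ _ _ hQ h2
        refine ⟨_, Step.comm hc (Step.loc L h1 ?_) h2, key _ _ this.2⟩
        rw [Act.allowed_iff, hc.chans, ← Act.allowed_iff]
        exact this.1

/-! Part 3 -/

theorem subst_closed (P : Tm) (T : Tm) :
    ∀ n m, Tm.ClosedAt n T → n ≤ m → Tm.subst P m T = T := by
  induction T with
  | nil => intros; rfl
  | var k =>
    intro n m h hnm
    simp only [Tm.ClosedAt] at h
    simp only [Tm.subst]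
    rw [if_neg (by omega)]
  | sum k a c ih =>
    intro n m h hnm
    simp only [Tm.subst]
    congr 1
    exact funext fun i => ih i n m (h i) hnm
  | oplus k a c ih =>
    intro n m h hnm
    simp only [Tm.subst]
    congr 1
    exact funext fun i => ih i n m (h i) hnm
  | par S T ih1 ih2 =>
    intro n m h hnm
    simp only [Tm.subst, ih1 n m h.1 hnm, ih2 n m h.2 hnm]
  | loc L T ih =>
    intro n m h hnm
    simp only [Tm.subst, ih n m h hnm]
  | fix T ih =>
    intro n m h hnm
    simp only [Tm.subst, ih (n+1) (m+1) h (by omega)]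

theorem closedAt_mono (T : Tm) : ∀ n m, Tm.ClosedAt n T → n ≤ m → Tm.ClosedAt m T := by
  induction T with
  | nil => intros; trivial
  | var k =>
    intro n m h hnm
    simp only [Tm.ClosedAt] at *
    omega
  | sum k a c ih => exact fun n m h hnm i => ih i n m (h i) hnm
  | oplus k a c ih => exact fun n m h hnm i => ih i n m (h i) hnm
  | par S T ih1 ih2 => exact fun n m h hnm => ⟨ih1 n m h.1 hnm, ih2 n m h.2 hnm⟩
  | loc L T ih => exact fun n m h hnm => ih n m h hnm
  | fix T ih => exact fun n m h hnm => ih (n+1) (m+1) h (by omega)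

theorem closedAt_subst (P : Tm) (hP : Tm.ClosedAt 0 P) (T : Tm) :
    ∀ n, Tm.ClosedAt (n+1) T → Tm.ClosedAt n (Tm.subst P n T) := by
  induction T with
  | nil => intros; trivial
  | var k =>
    intro n h
    simp only [Tm.ClosedAt] at h
    simp only [Tm.subst]
    split_ifs with hk
    · exact closedAt_mono P 0 n hP (by omega)
    · simp only [Tm.ClosedAt]
      omega
  | sum k a c ih => exact fun n h i => ih i n (h i)
  | oplus k a c ih => exact fun n h i => ih i n (h i)
  | par S T ih1 ih2 => exact fun n h => ⟨ih1 n h.1, ih2 n h.2⟩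
  | loc L T ih => exact fun n h => ih n h
  | fix T ih => exact fun n h => ih (n+1) h

theorem step_closed {P : Tm} {α : Act} {ρ : FinDist Tm} (h : Step P α ρ) :
    Tm.ClosedAt 0 P → ∀ Q, ρ.toFun Q ≠ 0 → Tm.ClosedAt 0 Q := by
  induction h with
  | choice a c i =>
    intro hP Q hQ
    rw [dirac_ne_zero hQ]
    exact hP i
  | oplus w c ρ hw hρ =>
    intro hP Q hQ
    obtain ⟨i, rfl⟩ := oplus_ne_zero hρ hQ
    exact hP i
  | parL T h ih =>
    intro hP Q hQ
    obtain ⟨A, B, hA, hB, rfl⟩ := parD_ne_zero hQ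
    rw [dirac_ne_zero hB]
    exact ⟨ih hP.1 _ hA, hP.2⟩
  | parR T h ih =>
    intro hP Q hQ
    obtain ⟨A, B, hA, hB, rfl⟩ := parD_ne_zero hQ
    rw [dirac_ne_zero hA]
    exact ⟨hP.1, ih hP.2 _ hB⟩
  | comm hc h1 h2 ih1 ih2 =>
    intro hP Q hQ
    obtain ⟨A, B, hA, hB, rfl⟩ := parD_ne_zero hQ
    exact ⟨ih1 hP.1 _ hA, ih2 hP.2 _ hB⟩
  | loc L h ha ih =>
    intro hP Q hQ
    obtain ⟨A, hA, rfl⟩ := locD_ne_zero hQ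
    exact ih hP A hA
  | @fixp T β ρ h ih =>
    intro hP
    exact ih (closedAt_subst (.fix T) hP T 0 hP)

/-- Congruence closure of strong bisimilarity on closed terms. -/
inductive Cg : Tm → Tm → Prop where
  | bis {P Q : Tm} : Tm.ClosedAt 0 P → Tm.ClosedAt 0 Q → StrongBisim P Q → Cg P Q
  | nil : Cg .nil .nil
  | var (n : ℕ) : Cg (.var n) (.var n)
  | sum (k : ℕ) (a : Fin (k+1) → Act) (c c' : Fin (k+1) → Tm) :
      (∀ i, Cg (c i) (c' i)) → Cg (.sum k a c) (.sum k a c')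
  | oplus (k : ℕ) (w : Fin (k+1) → ℝ) (c c' : Fin (k+1) → Tm) :
      (∀ i, Cg (c i) (c' i)) → Cg (.oplus k w c) (.oplus k w c')
  | par {S S' T T' : Tm} : Cg S S' → Cg T T' → Cg (.par S T) (.par S' T')
  | loc (L : Finset Chan) {T T' : Tm} : Cg T T' → Cg (.loc L T) (.loc L T')
  | fix {T T' : Tm} : Cg T T' → Cg (.fix T) (.fix T')

theorem Cg.refl (T : Tm) : Cg T T := by
  induction T with
  | nil => exact .nil
  | var n => exact .var n
  | sum k a c ih => exact .sum k a c c ih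
  | oplus k a c ih => exact .oplus k a c c ih
  | par S T ih1 ih2 => exact .par ih1 ih2
  | loc L T ih => exact .loc L ih
  | fix T ih => exact .fix ih

theorem Cg.symm {S T : Tm} (h : Cg S T) : Cg T S := by
  induction h with
  | bis h1 h2 h => exact .bis h2 h1 h.symm
  | nil => exact .nil
  | var n => exact .var n
  | sum k a c c' _ ih => exact .sum k a c' c ih
  | oplus k a c c' _ ih => exact .oplus k a c' c ih
  | par _ _ ih1 ih2 => exact .par ih1 ih2
  | loc L _ ih => exact .loc L ih
  | fix _ ih => exact .fix ih

theorem Cg.subst {P Q S T : Tm} (hPQ : Cg P Q) (h : Cg S T) :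
    ∀ n, Cg (Tm.subst P n S) (Tm.subst Q n T) := by
  induction h with
  | bis h1 h2 h =>
    intro n
    rw [subst_closed _ _ 0 n h1 (by omega), subst_closed _ _ 0 n h2 (by omega)]
    exact .bis h1 h2 h
  | nil => exact fun _ => .nil
  | var m =>
    intro n
    simp only [Tm.subst]
    split_ifs
    · exact hPQ
    · exact .var m
  | sum k a c c' _ ih => exact fun n => .sum k a _ _ fun i => ih i n
  | oplus k a c c' _ ih => exact fun n => .oplus k a _ _ fun i => ih i n
  | par _ _ ih1 ih2 => exact fun n => .par (ih1 n) (ih2 n)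
  | loc L _ ih => exact fun n => .loc L (ih n)
  | fix _ ih => exact fun n => .fix (ih (n+1))

theorem cg_bis_step {P Q : Tm} (h1 : Tm.ClosedAt 0 P) (h2 : Tm.ClosedAt 0 Q)
    (h : StrongBisim P Q) {α : Act} {ρ : FinDist Tm} (hs : Step P α ρ) :
    ∃ ρ', Step Q α ρ' ∧ Coup Cg ρ ρ' := by
  obtain ⟨ρ', h3, h4⟩ := h.fwd hs
  exact ⟨ρ', h3, h4.mono fun A B hA hB hAB =>
    .bis (step_closed hs h1 A hA) (step_closed h3 h2 B hB) hAB⟩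

theorem cg_step {P : Tm} {α : Act} {ρ : FinDist Tm} (hs : Step P α ρ) :
    ∀ Q, Cg P Q → ∃ ρ', Step Q α ρ' ∧ Coup Cg ρ ρ' := by
  induction hs with
  | choice a c i =>
    intro Q hQ
    cases hQ with
    | bis h1 h2 h => exact cg_bis_step h1 h2 h (Step.choice a c i)
    | sum _ _ _ c' h => exact ⟨_, Step.choice a c' i, coup_dirac (h i)⟩
  | @oplus k w c ρ hw hρ =>
    intro Q hQ
    cases hQ with
    | bis h1 h2 h => exact cg_bis_step h1 h2 h (Step.oplus w c ρ hw hρ)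
    | oplus _ _ _ c' h =>
      have h0 : ∀ i, 0 ≤ w i := fun i => (hw i).1.le
      have hsum : ∑ i, w i = 1 := by
        have := E_of_decomp hρ (fun _ => 1)
        rw [E_one] at this
        simpa using this.symm
      have hρ' : ∀ Q, ((ofFintype w h0 hsum).map c').toFun Q
          = ∑ i, if c' i = Q then w i else 0 := by
        intro Q
        rw [map_toFun, E_fintype]
        simp [ofFintype]
      exact ⟨_, Step.oplus w c' _ hw hρ', coup_of_decomp h0 hρ hρ' h⟩
  | parL T hs ih =>
    intro Q hQ
    cases hQ with
    | bis h1 h2 h => exact cg_bis_step h1 h2 h (Step.parL T hs)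
    | par h1 h2 =>
      obtain ⟨ρ', h3, h4⟩ := ih _ h1
      exact ⟨_, Step.parL _ h3, h4.par (coup_dirac h2) fun _ _ _ _ => .par⟩
  | parR T hs ih =>
    intro Q hQ
    cases hQ with
    | bis h1 h2 h => exact cg_bis_step h1 h2 h (Step.parR T hs)
    | par h1 h2 =>
      obtain ⟨ρ', h3, h4⟩ := ih _ h2
      exact ⟨_, Step.parR _ h3, (coup_dirac h1).par h4 fun _ _ _ _ => .par⟩
  | comm hc hs1 hs2 ih1 ih2 =>
    intro Q hQ
    cases hQ with
    | bis h1 h2 h => exact cg_bis_step h1 h2 h (Step.comm hc hs1 hs2)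
    | par h1 h2 =>
      obtain ⟨ρ', h3, h4⟩ := ih1 _ h1
      obtain ⟨σ', h5, h6⟩ := ih2 _ h2
      exact ⟨_, Step.comm hc h3 h5, h4.par h6 fun _ _ _ _ => .par⟩
  | loc L hs ha ih =>
    intro Q hQ
    cases hQ with
    | bis h1 h2 h => exact cg_bis_step h1 h2 h (Step.loc L hs ha)
    | loc _ h =>
      obtain ⟨ρ', h3, h4⟩ := ih _ h
      exact ⟨_, Step.loc L h3 ha, h4.loc L fun _ _ => .loc L⟩
  | fixp hs ih =>
    intro Q hQ
    cases hQ with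
    | bis h1 h2 h => exact cg_bis_step h1 h2 h (Step.fixp hs)
    | fix h =>
      obtain ⟨ρ', h3, h4⟩ := ih _ ((Cg.fix h).subst h 0)
      exact ⟨_, Step.fixp h3, h4⟩

theorem sb_subst (R P Q : Tm) (hP : Tm.ClosedAt 0 P) (hQ : Tm.ClosedAt 0 Q)
    (h : StrongBisim P Q) : StrongBisim (Tm.subst P 0 R) (Tm.subst Q 0 R) :=
  sb_of_sim Cg (fun _ _ => Cg.symm) (fun P Q h _ _ hs => cg_step hs Q h)
    ((Cg.bis hP hQ h).subst (Cg.refl R) 0)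

/-! Part 4 -/

theorem Internal.refl (μ : FinDist Tm) : Internal μ μ := ⟨[], by simp, rfl⟩

theorem PSeq.append {π1 π2 : List (Act × ℝ)} : ∀ {μ ν ξ : FinDist Tm}, PSeq μ π1 ν →
    PSeq ν π2 ξ → PSeq μ (π1 ++ π2) ξ := by
  induction π1 with
  | nil => intro μ ν ξ h1 h2; cases h1; exact h2
  | cons s π ih =>
    rintro μ ν ξ ⟨μ', h, h1⟩ h2
    exact ⟨μ', h, ih h1 h2⟩

theorem Internal.trans {μ ν ξ : FinDist Tm} (h1 : Internal μ ν) (h2 : Internal ν ξ) :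
    Internal μ ξ := by
  obtain ⟨π1, a1, b1⟩ := h1
  obtain ⟨π2, a2, b2⟩ := h2
  refine ⟨π1 ++ π2, ?_, b1.append b2⟩
  intro s hs
  rcases List.mem_append.1 hs with h | h
  · exact a1 s h
  · exact a2 s h

theorem Internal.single {μ ν : FinDist Tm} {p : ℝ} (h : PStep μ .tau p ν) : Internal μ ν :=
  ⟨[(.tau, p)], by simp, ν, h, rfl⟩

theorem E_of_shift {μ ν ρ : FinDist Tm} {P : Tm} {c : ℝ}
    (h : ∀ Q, ν.toFun Q = μ.toFun Q + c * (ρ.toFun Q - (if Q = P then 1 else 0)))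
    (f : Tm → ℝ) : ν.E f = μ.E f + c * (ρ.E f - f P) := by
  let s := ν.supp ∪ (μ.supp ∪ (ρ.supp ∪ (dirac P).supp))
  rw [← E_dirac P f, E_eq_sum ν f s, E_eq_sum μ f s, E_eq_sum ρ f s, E_eq_sum (dirac P) f s,
    ← Finset.sum_sub_distrib, Finset.mul_sum, ← Finset.sum_add_distrib]
  · refine Finset.sum_congr rfl fun Q _ => ?_
    rw [h Q]
    simp only [dirac]
    ring
  all_goals
    intro a ha
    have := mem_supp.2 ha
    simp only [s, Finset.mem_union]
    tauto

theorem exists_pstep {μ ρ : FinDist Tm} {P : Tm} {α : Act} {p : ℝ} (hs : Step P α ρ)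
    (hP : 0 < μ.toFun P) (h0 : 0 < p) (h1 : p ≤ 1) : ∃ ν, PStep μ α p ν ∧
      ∀ f, ν.E f = μ.E f + μ.toFun P * p * (ρ.E f - f P) := by
  let g : Tm → ℝ := fun Q =>
    μ.toFun Q + μ.toFun P * p * (ρ.toFun Q - (if Q = P then 1 else 0))
  let s := μ.supp ∪ (ρ.supp ∪ (dirac P).supp)
  have hsub : ∀ Q, g Q ≠ 0 → Q ∈ s := by
    intro Q hQ
    by_contra hc
    simp only [s, Finset.mem_union, mem_supp, not_or, not_not] at hc
    apply hQ
    have h3 : (if Q = P then (1:ℝ) else 0) = 0 := hc.2.2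
    simp only [g]
    rw [hc.1, hc.2.1, h3]
    ring
  let ν : FinDist Tm :=
    { toFun := g
      nonneg := by
        intro Q
        simp only [g]
        have hr := ρ.nonneg Q
        have hm := μ.nonneg Q
        have hpp := mul_pos hP h0
        split_ifs with hQ
        · subst hQ
          nlinarith [mul_nonneg hpp.le hr]
        · nlinarith [mul_nonneg hpp.le hr]
      finite_support := s.finite_toSet.subset fun x hx => hsub x hx
      sum_one := by
        rw [finsum_eq_finsetSum_of_support_subset g (s := s) (fun x hx => hsub x hx)]
        have e1 := E_eq_sum μ (fun _ => 1) s
          (fun a ha => Finset.mem_union_left _ (mem_supp.2 ha))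
        have e2 := E_eq_sum ρ (fun _ => 1) s
          (fun a ha => Finset.mem_union_right _ (Finset.mem_union_left _ (mem_supp.2 ha)))
        have e3 := E_eq_sum (dirac P) (fun _ => 1) s
          (fun a ha => Finset.mem_union_right _ (Finset.mem_union_right _ (mem_supp.2 ha)))
        rw [E_one] at e1 e2 e3
        simp only [mul_one] at e1 e2 e3
        simp only [g]
        rw [Finset.sum_add_distrib, ← Finset.mul_sum, Finset.sum_sub_distrib, ← e1, ← e2]
        have e4 : ∑ x ∈ s, (if x = P then (1:ℝ) else 0) = 1 := e3.symm
        rw [e4]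
        ring }
  have hν : ∀ Q, ν.toFun Q
      = μ.toFun Q + μ.toFun P * p * (ρ.toFun Q - (if Q = P then 1 else 0)) := fun Q => rfl
  exact ⟨ν, ⟨h0, h1, P, ρ, hP, hs, hν⟩, E_of_shift hν⟩

theorem multi_step (μ : FinDist Tm) (κ : Tm → FinDist Tm) (q : ℝ) (q0 : 0 < q) (q1 : q ≤ 1)
    (s : Finset Tm) : (∀ Q ∈ s, 0 < μ.toFun Q ∧ Step Q .tau (κ Q)) →
    ∃ ν, Internal μ ν ∧
      ∀ f, ν.E f = μ.E f + ∑ Q ∈ s, μ.toFun Q * q * ((κ Q).E f - f Q) := by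
  induction s using Finset.induction_on with
  | empty => exact fun _ => ⟨μ, Internal.refl μ, by simp⟩
  | insert Q s hQ ih =>
    intro H
    obtain ⟨ν, h1, h2⟩ := ih fun A hA => H A (Finset.mem_insert_of_mem hA)
    obtain ⟨hpos, hst⟩ := H Q (Finset.mem_insert_self _ _)
    have hle : μ.toFun Q ≤ ν.toFun Q := by
      rw [← E_single ν Q, h2, E_single]
      refine le_add_of_nonneg_right (Finset.sum_nonneg fun A hA => ?_)
      have hne : A ≠ Q := fun h => hQ (h ▸ hA)
      rw [E_single, if_neg hne, sub_zero]
      exact mul_nonneg (mul_nonneg (μ.nonneg _) q0.le) ((κ A).nonneg _)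
    have hνpos : 0 < ν.toFun Q := lt_of_lt_of_le hpos hle
    obtain ⟨ξ, h3, h4⟩ := exists_pstep (p := μ.toFun Q * q / ν.toFun Q) hst hνpos
      (div_pos (mul_pos hpos q0) hνpos)
      (by rw [div_le_one hνpos]; nlinarith)
    refine ⟨ξ, h1.trans (Internal.single h3), fun f => ?_⟩
    rw [h4, h2, Finset.sum_insert hQ, mul_div_cancel₀ _ hνpos.ne']
    ring

theorem one_step {μ1 μ2 ν1 : FinDist Tm} {p : ℝ} (h : EqLift StrongBisim μ1 μ2)
    (hs : PStep μ1 .tau p ν1) : ∃ ν2, Internal μ2 ν2 ∧ EqLift StrongBisim ν1 ν2 := by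
  obtain ⟨p0, p1, P, ρ, hP, hst, hν⟩ := hs
  have hE := StrongBisim.equivalence
  have hex : ∀ Q, ∃ σ, StrongBisim P Q → Step Q .tau σ ∧ Coup StrongBisim ρ σ := by
    intro Q
    by_cases hQ : StrongBisim P Q
    · obtain ⟨σ, h1, h2⟩ := hQ.fwd hst
      exact ⟨σ, fun _ => ⟨h1, h2⟩⟩
    · exact ⟨ρ, fun h => absurd h hQ⟩
  choose κ hκ using hex
  let m := μ1.mass {Q | StrongBisim P Q}
  have hm1 : μ1.toFun P ≤ m := by
    simp only [m]
    rw [mass_eq, E_supp]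
    have := Finset.single_le_sum (s := μ1.supp)
      (f := fun a => μ1.toFun a * (if a ∈ {Q | StrongBisim P Q} then 1 else 0))
      (fun i _ => mul_nonneg (μ1.nonneg i) (by split_ifs <;> norm_num))
      (mem_supp.2 hP.ne')
    have hmem : P ∈ {Q | StrongBisim P Q} := hE.refl P
    simpa [hmem, hE.refl P] using this
  have hm0 : 0 < m := lt_of_lt_of_le hP hm1
  let s := μ2.supp.filter fun Q => StrongBisim P Q
  have hm2 : ∑ Q ∈ s, μ2.toFun Q = m := by
    simp only [m, s]
    rw [h P, mass_eq, E_supp, Finset.sum_filter]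
    refine Finset.sum_congr rfl fun b _ => ?_
    simp
  obtain ⟨ν2, h1, h2⟩ := multi_step μ2 κ (μ1.toFun P * p / m) (div_pos (mul_pos hP p0) hm0)
    (by rw [div_le_one hm0]; nlinarith) s (by
      intro Q hQ
      obtain ⟨ha, hb⟩ := Finset.mem_filter.1 hQ
      exact ⟨lt_of_le_of_ne (μ2.nonneg Q) (mem_supp.1 ha).symm, (hκ Q hb).1⟩)
  refine ⟨ν2, h1, fun X => ?_⟩
  have hX := h X
  rw [mass_eq, mass_eq] at hX ⊢
  rw [E_of_shift hν, h2, hX]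
  congr 1
  have hsum : ∀ Q ∈ s, μ2.toFun Q * (μ1.toFun P * p / m)
      * ((κ Q).E (fun a => if a ∈ {Q | StrongBisim X Q} then 1 else 0)
        - (if Q ∈ {Q | StrongBisim X Q} then 1 else 0))
      = μ2.toFun Q * ((μ1.toFun P * p / m)
      * (ρ.E (fun a => if a ∈ {Q | StrongBisim X Q} then 1 else 0)
        - (if P ∈ {Q | StrongBisim X Q} then 1 else 0))) := by
    intro Q hQ
    have hb := (Finset.mem_filter.1 hQ).2
    have e1 := (hκ Q hb).2.eqLift hE (fun _ _ h => h) X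
    rw [mass_eq, mass_eq] at e1
    have e2 : Q ∈ {Q | StrongBisim X Q} ↔ P ∈ {Q | StrongBisim X Q} :=
      ⟨fun h1 => hE.trans h1 (hE.symm hb), fun h1 => hE.trans h1 hb⟩
    rw [← e1]
    simp only [e2]
    ring
  rw [Finset.sum_congr rfl hsum, ← Finset.sum_mul, hm2, ← mul_assoc,
    mul_div_cancel₀ _ hm0.ne']

theorem seq_match {π : List (Act × ℝ)} : ∀ {μ1 μ2 ν1 : FinDist Tm},
    (∀ s ∈ π, s.1 = Act.tau) → EqLift StrongBisim μ1 μ2 → PSeq μ1 π ν1 →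
    ∃ ν2, Internal μ2 ν2 ∧ EqLift StrongBisim ν1 ν2 := by
  induction π with
  | nil =>
    intro μ1 μ2 ν1 _ h hs
    cases hs
    exact ⟨μ2, Internal.refl _, h⟩
  | cons s π ih =>
    rintro μ1 μ2 ν1 ht h ⟨μ', h1, h2⟩
    rw [ht s (by simp)] at h1
    obtain ⟨μ'', h3, h4⟩ := one_step h h1
    obtain ⟨ν2, h5, h6⟩ := ih (fun s hs => ht s (by simp [hs])) h4 h2
    exact ⟨ν2, h3.trans h5, h6⟩

/-- structural properties of probabilistic strong bisimilarity.
(1) `P|Q ∼p Q|P`, `P|0 ∼p P`, `(P|Q)|A ∼p P|(Q|A)`, `μX.T ∼p T{μX.T/X}`;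
(2) if no channel of `Q` lies in `L` then `(L)Q ∼p Q` and `((L)P)|Q ∼p (L)(P|Q)`;
(3) `∼p` is preserved by substitution into a 1-ary term `R`;
(4) `∼p†`-related distributions can match internal transition sequences up to `∼p†`. -/
theorem strong_bisim_properties :
    (∀ P Q A : Tm, P.IsProc → Q.IsProc → A.IsProc →
      StrongBisim (.par P Q) (.par Q P) ∧
      StrongBisim (.par P .nil) P ∧
      StrongBisim (.par (.par P Q) A) (.par P (.par Q A))) ∧
    (∀ T : Tm, Tm.ClosedAt 1 T → T.NoOmega →
      StrongBisim (.fix T) (Tm.subst (.fix T) 0 T)) ∧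
    (∀ (L : Finset Chan) (P Q : Tm), P.IsProc → Q.IsProc → L ∩ Q.chans = ∅ →
      StrongBisim (.loc L Q) Q ∧
      StrongBisim (.par (.loc L P) Q) (.loc L (.par P Q))) ∧
    (∀ (R P Q : Tm), Tm.ClosedAt 1 R → R.NoOmega → P.IsProc → Q.IsProc →
      StrongBisim P Q → StrongBisim (Tm.subst P 0 R) (Tm.subst Q 0 R)) ∧
    (∀ μ1 μ2 ν1 : FinDist Tm,
      μ1.IsProcDist → μ2.IsProcDist → ν1.IsProcDist →
      EqLift StrongBisim μ1 μ2 → Internal μ1 ν1 →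
      ∃ ν2 : FinDist Tm, Internal μ2 ν2 ∧ EqLift StrongBisim ν1 ν2) := by
  refine ⟨?_, ?_, ?_, ?_, ?_⟩
  · intro P Q A _ _ _
    exact ⟨sb_par_comm P Q, sb_par_nil P, sb_par_assoc P Q A⟩
  · intro T _ _
    exact sb_fix T
  · intro L P Q _ _ h
    have hd : Disjoint L Q.chans := Finset.disjoint_iff_inter_eq_empty.2 h
    exact ⟨sb_loc L Q hd, sb_loc_par L P Q hd⟩
  · intro R P Q _ _ hP hQ h
    exact sb_subst R P Q hP.1 hQ.1 h
  · rintro μ1 μ2 ν1 _ _ _ h ⟨π, ht, hs⟩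
    exact seq_match ht h hs
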